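/- Let 0 < ε < 1, 0 < δ < 1, K ≥ 1 (an integer), T ≥ 1, with KT/(εδ) ≥ 9. If M ≥ (2K/ε)·log(KT/(εδ)), then T^K (M+1)^K e^{-Mε} ≤ δ. -/

import Mathlib

open Real

/-- Ensemble size bound: if `0 < ε < 1`, `0 < δ < 1`, `K ≥ 1`, `T ≥ 1`,
`K·T/(ε·δ) ≥ 9`, and `M ≥ (2K/ε)·log(K·T/(ε·δ))`, then
`T^K (M+1)^K e^{-Mε} ≤ δ`. -/
theorem ensemble_size_bound (K T M : ℕ) (ε δ : ℝ)
    (hε : 0 < ε) (hε1 : ε < 1) (hδ : 0 < δ) (hδ1 : δ < 1)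
    (hK : 1 ≤ K) (hT : 1 ≤ T)
    (h9 : 9 ≤ (K : ℝ) * T / (ε * δ))
    (hM : (2 * K / ε) * Real.log ((K : ℝ) * T / (ε * δ)) ≤ (M : ℝ)) :
    (T : ℝ) ^ K * ((M : ℝ) + 1) ^ K * Real.exp (-(M * ε)) ≤ δ := by 
  have hK' : (1 : ℝ) ≤ K := by exact_mod_cast hK
  have hT' : (1 : ℝ) ≤ T := by exact_mod_cast hT
  have hK0 : (0 : ℝ) < K := by linarith
  have hT0 : (0 : ℝ) < T := by linarith
  have hM0 : (0 : ℝ) ≤ M := Nat.cast_nonneg M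
  obtain ⟨X, hX⟩ : ∃ X : ℝ, X = (K : ℝ) * T / (ε * δ) := ⟨_, rfl⟩
  rw [← hX] at h9 hM
  have hX0 : 0 < X := by linarith
  have he1 := Real.exp_one_gt_d9
  have he2 := Real.exp_one_lt_d9
  obtain ⟨L, hL⟩ : ∃ L : ℝ, L = Real.log X := ⟨_, rfl⟩
  rw [← hL] at hM
  have hL1 : 1 ≤ L := by
    rw [hL, Real.le_log_iff_exp_le hX0]; linarith
  have hLX : 2 * L + 1 ≤ X := by
    have h1 := Real.log_le_sub_one_of_pos (div_pos hX0 (Real.exp_pos 1))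
    rw [Real.log_div hX0.ne' (Real.exp_pos 1).ne', Real.log_exp, ← hL] at h1
    have h2 : X / Real.exp 1 ≤ X / 2.7 := by gcongr; linarith
    have h3 : X / 2.7 ≤ 0.375 * X := by
      rw [div_le_iff₀ (by norm_num)]; nlinarith
    linarith
  obtain ⟨m, hm⟩ : ∃ m : ℝ, m = 2 * K / ε * L := ⟨_, rfl⟩
  rw [← hm] at hM
  have hmε : m * ε = 2 * K * L := by rw [hm]; field_simp
  have hm0 : 0 ≤ m := by rw [hm]; positivity
  have hA0 : 0 < m + 1 := by linarith
  have hKA : (K : ℝ) / (m + 1) ≤ ε := by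
    rw [div_le_iff₀ hA0]; nlinarith
  have hlogM : Real.log ((M : ℝ) + 1) ≤ Real.log (m + 1) + (M - m) / (m + 1) := by
    have h1 := Real.log_le_sub_one_of_pos (div_pos (by linarith : (0 : ℝ) < M + 1) hA0)
    rw [Real.log_div (by linarith) hA0.ne'] at h1
    have h2 : ((M : ℝ) + 1) / (m + 1) - 1 = (M - m) / (m + 1) := by
      field_simp; ring
    linarith
  have hKM : (K : ℝ) * ((M - m) / (m + 1)) ≤ ε * (M - m) := by
    have h1 := mul_le_mul_of_nonneg_right hKA (by linarith : (0 : ℝ) ≤ M - m)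
    calc (K : ℝ) * ((M - m) / (m + 1)) = K / (m + 1) * (M - m) := by ring
      _ ≤ _ := h1
  have hmain : Real.log T - Real.log δ + Real.log (m + 1) ≤ 2 * L := by
    have h1 : (T : ℝ) / δ * (m + 1) ≤ X ^ 2 := by
      have h2 : (T : ℝ) / δ * (m + 1) = X * (2 * L + ε / K) := by
        rw [hm, hX]; field_simp
      have h3 : ε / K ≤ 1 := by rw [div_le_one hK0]; linarith
      rw [h2, sq]
      gcongr
      linarith
    have h4 := Real.log_le_log (by positivity) h1
    rw [Real.log_mul (by positivity) hA0.ne', Real.log_div hT0.ne' hδ.ne', Real.log_pow,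
      ← hL] at h4
    push_cast at h4
    exact h4
  have hlδ : Real.log δ ≤ 0 := Real.log_nonpos hδ.le hδ1.le
  have hpos : 0 < (T : ℝ) ^ K * ((M : ℝ) + 1) ^ K * Real.exp (-(M * ε)) := by positivity
  rw [← Real.log_le_log_iff hpos hδ, Real.log_mul (by positivity) (by positivity),
    Real.log_mul (by positivity) (by positivity), Real.log_pow, Real.log_pow, Real.log_exp]
  have h5 := mul_le_mul_of_nonneg_left hmain hK0.le
  have h6 := mul_le_mul_of_nonneg_left hlogM hK0.le
  have h7 : (K : ℝ) * Real.log δ ≤ Real.log δ := by nlinarith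
  nlinarith
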